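/- arXiv:2502.15567 — 2 statements merged into one kernel-verified Lean document; each statement's English description precedes it below -/
import Mathlib

section
/- Let n ≥ 1, k ≥ 1, U > 0, and let Φ ∈ ℝ^{n×(k+1)} have full column rank. Let u ∈ ℝ^{k+1} be the last standard basis vector, e₁ = Φu, e₂ = Φ(ΦᵀΦ)^{−1}u, v = e₁/‖e₁‖₂ + e₂/‖e₂‖₂, and define the perturbation e = √(nU) · v/‖v‖₂. Let y₀ ∈ ℝⁿ be any vector in the span of the first k columns of Φ (i.e., in the column space of the order-(k−1) design), and set ỹ = y₀ + e. Then for every q with 0 ≤ q < k and every β ∈ ℝ^{q+1}, the normalized residual satisfies n^{−1} ‖ỹ − Φ_q β‖₂² ≥ U/2, where Φ_q ∈ ℝ^{n×(q+1)} consists of the first q+1 columns of Φ. Moreover, ỹ lies in the column space of Φ, so min_β ‖ỹ − Φβ‖₂ = 0. -/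
open Matrix

/-- The Euclidean (`ℓ₂`) norm of a vector in `ℝⁿ`. -/
noncomputable def e2norm {n : ℕ} (v : Fin n → ℝ) : ℝ := Real.sqrt (∑ i, v i ^ 2)

/-- The "Order Disguise" perturbation (Algorithm 1): with `u` the last standard basis vector,
`e₁ = Φu`, `e₂ = Φ(ΦᵀΦ)⁻¹u`, `v = e₁/‖e₁‖₂ + e₂/‖e₂‖₂`, the perturbation is
`e = √(nU) · v/‖v‖₂`. -/
noncomputable def odPerturb {n k : ℕ} (U : ℝ) (Φ : Matrix (Fin n) (Fin (k + 1)) ℝ) :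
    Fin n → ℝ :=
  let u : Fin (k + 1) → ℝ := Pi.single (Fin.last k) 1
  let e₁ : Fin n → ℝ := Φ.mulVec u
  let e₂ : Fin n → ℝ := Φ.mulVec ((Φᵀ * Φ)⁻¹.mulVec u)
  let v : Fin n → ℝ := (e2norm e₁)⁻¹ • e₁ + (e2norm e₂)⁻¹ • e₂
  (Real.sqrt (n * U) / e2norm v) • v


theorem e2norm_sq' {n : ℕ} (v : Fin n → ℝ) : e2norm v ^ 2 = v ⬝ᵥ v := by
  unfold e2norm
  rw [Real.sq_sqrt (Finset.sum_nonneg fun i _ => sq_nonneg _)]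
  simp [dotProduct, sq]

theorem e2norm_cs {n : ℕ} (v w : Fin n → ℝ) :
    (v ⬝ᵥ w) ^ 2 ≤ e2norm v ^ 2 * e2norm w ^ 2 := by
  unfold e2norm
  rw [Real.sq_sqrt (Finset.sum_nonneg fun i _ => sq_nonneg _),
    Real.sq_sqrt (Finset.sum_nonneg fun i _ => sq_nonneg _)]
  exact Finset.sum_mul_sq_le_sq_mul_sq _ _ _

theorem e2norm_nonneg' {n : ℕ} (v : Fin n → ℝ) : 0 ≤ e2norm v := Real.sqrt_nonneg _

/-- Central deterministic step for Order Disguise: if `y₀` lies in the span of the first `k`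
columns of `Φ` and `ỹ = y₀ + e` with `e` the Order Disguise perturbation at utility-loss level
`U`, then every polynomial fit of order `q < k` has normalized residual
`n⁻¹‖ỹ - Φ_q β‖₂² ≥ U/2`, while `ỹ` lies in the column space of `Φ`, so
`min_β ‖ỹ - Φβ‖₂ = 0`. -/
theorem stmt7 (n k : ℕ) (hn : 1 ≤ n) (hk : 1 ≤ k) (U : ℝ) (hU : 0 < U)
    (Φ : Matrix (Fin n) (Fin (k + 1)) ℝ) (hΦ : IsUnit (Φᵀ * Φ))
    (y₀ : Fin n → ℝ)
    (hy₀ : ∃ β : Fin (k + 1) → ℝ, β (Fin.last k) = 0 ∧ y₀ = Φ.mulVec β) :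
    (∀ q : ℕ, ∀ hq : q < k, ∀ β : Fin (q + 1) → ℝ,
      U / 2 ≤ (1 / (n : ℝ)) *
        e2norm ((y₀ + odPerturb U Φ) -
          (Φ.submatrix id (Fin.castLE (Nat.succ_le_succ hq.le))).mulVec β) ^ 2) ∧
    (∃ β : Fin (k + 1) → ℝ, y₀ + odPerturb U Φ = Φ.mulVec β) ∧
    (⨅ β : Fin (k + 1) → ℝ, e2norm ((y₀ + odPerturb U Φ) - Φ.mulVec β)) = 0 := by
  have hrange : ∃ β : Fin (k + 1) → ℝ, y₀ + odPerturb U Φ = Φ.mulVec β := by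
    obtain ⟨β, -, rfl⟩ := hy₀
    unfold odPerturb
    simp only [← Matrix.mulVec_smul, ← Matrix.mulVec_add]
    exact ⟨_, rfl⟩
  refine ⟨?_, hrange, ?_⟩
  · intro q hq β
    obtain ⟨β₀, hβ₀, rfl⟩ := hy₀
    unfold odPerturb
    extract_lets u e₁ e₂ v
    have hdet : IsUnit (Φᵀ * Φ).det := (Matrix.isUnit_iff_isUnit_det _).1 hΦ
    have hvm : e₂ ᵥ* Φ = u := by
      rw [← Matrix.mulVec_transpose]
      simp only [e₂, Matrix.mulVec_mulVec]
      rw [← Matrix.mul_assoc, Matrix.mul_nonsing_inv _ hdet, Matrix.one_mulVec]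
    have key : ∀ γ : Fin (k + 1) → ℝ, e₂ ⬝ᵥ Φ.mulVec γ = γ (Fin.last k) := by
      intro γ
      rw [Matrix.dotProduct_mulVec, hvm]
      simp [u]
    have hsub : e₂ ⬝ᵥ (Φ.submatrix id (Fin.castLE (Nat.succ_le_succ hq.le))).mulVec β = 0 := by
      rw [Matrix.dotProduct_mulVec]
      have h : e₂ ᵥ* (Φ.submatrix id (Fin.castLE (Nat.succ_le_succ hq.le))) = 0 := by
        ext j
        have h1 := congrFun hvm (Fin.castLE (Nat.succ_le_succ hq.le) j)
        have h2 : Fin.castLE (Nat.succ_le_succ hq.le) j ≠ Fin.last k := by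
          intro h
          have := congrArg Fin.val h
          simp at this
          omega
        have h3 : u (Fin.castLE (Nat.succ_le_succ hq.le) j) = 0 := by
          simp only [u]
          exact Pi.single_eq_of_ne h2 _
        rw [h3] at h1
        exact h1
      rw [h, zero_dotProduct]
    have h21 : e₂ ⬝ᵥ e₁ = 1 := by
      simp only [e₁]
      rw [key]
      simp [u]
    have h12 : e₁ ⬝ᵥ e₂ = 1 := by rw [dotProduct_comm]; exact h21
    have hs1 := e2norm_sq' e₁
    have hs2 := e2norm_sq' e₂
    have hN := e2norm_sq' v
    have hcs := e2norm_cs e₁ e₂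
    rw [h12] at hcs
    have p1 : 0 < e2norm e₁ := by
      refine lt_of_le_of_ne (e2norm_nonneg' _) fun h => ?_
      rw [← h] at hcs; norm_num at hcs
    have p2 : 0 < e2norm e₂ := by
      refine lt_of_le_of_ne (e2norm_nonneg' _) fun h => ?_
      rw [← h] at hcs; norm_num at hcs
    set a := e2norm e₁ with ha
    set b := e2norm e₂ with hb
    obtain ⟨c, hc⟩ : ∃ c, c = a⁻¹ * b⁻¹ := ⟨_, rfl⟩
    have pc : 0 < c := by rw [hc]; positivity
    have hv2 : e₂ ⬝ᵥ v = b * (1 + c) := by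
      simp only [v, dotProduct_add, dotProduct_smul, h21, ← hs2, smul_eq_mul, hc, ← ha, ← hb]
      field_simp
      ring
    have hvv : e2norm v ^ 2 = 2 * (1 + c) := by
      rw [hN]
      simp only [v, dotProduct_add, add_dotProduct, smul_dotProduct, dotProduct_smul, h21, h12,
        ← hs1, ← hs2, smul_eq_mul, hc, ← ha, ← hb]
      field_simp
      ring
    set t := Real.sqrt (n * U) / e2norm v with ht
    have hn0 : (0 : ℝ) < n := by exact_mod_cast hn
    have ht2 : t ^ 2 * (2 * (1 + c)) = n * U := by
      rw [ht, div_pow, Real.sq_sqrt (by positivity), hvv]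
      field_simp
    have hcs2 := e2norm_cs e₂ ((Φ.mulVec β₀ + t • v) -
          (Φ.submatrix id (Fin.castLE (Nat.succ_le_succ hq.le))).mulVec β)
    rw [dotProduct_sub, dotProduct_add, key, hβ₀, hsub, dotProduct_smul, hv2, smul_eq_mul,
      ← hb] at hcs2
    generalize e2norm ((Φ.mulVec β₀ + t • v) -
          (Φ.submatrix id (Fin.castLE (Nat.succ_le_succ hq.le))).mulVec β) = R at hcs2 ⊢
    have h1 : (t * (1 + c)) ^ 2 ≤ R ^ 2 := by
      refine le_of_mul_le_mul_left ?_ (pow_pos p2 2)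
      calc _ = (0 + t * (b * (1 + c)) - 0) ^ 2 := by ring
        _ ≤ _ := hcs2
    have h2 : n * U / 2 ≤ (t * (1 + c)) ^ 2 := by
      rw [← ht2]
      nlinarith [mul_nonneg (mul_nonneg (sq_nonneg t) pc.le) (by linarith : (0 : ℝ) ≤ 1 + c)]
    have h3 := h2.trans h1
    rw [one_div, inv_mul_eq_div, le_div_iff₀ hn0]
    linarith
  · obtain ⟨β, hβ⟩ := hrange
    refine le_antisymm ?_ (Real.iInf_nonneg fun _ => e2norm_nonneg' _)
    refine (ciInf_le ⟨0, ?_⟩ β).trans ?_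
    · rintro _ ⟨γ, rfl⟩
      exact e2norm_nonneg' _
    · rw [hβ]
      simp [e2norm]
end

section
/- Let X be a standard Gaussian random variable. There exists a constant C₀ > 0 such that for any sequence of positive integers (q_n) with q_n ≥ C₀ ln n for all large n, one has n · P(|X| ≥ (E[X^{2q_n}] / q_n²)^{1/(2q_n)}) → 0 as n → ∞. -/
open MeasureTheory ProbabilityTheory Filter

lemma moment_eq (q : ℕ) : ∫ t, t ^ (2 * q) ∂(gaussianReal 0 1)
    = 2 ^ q * Real.Gamma ((q : ℝ) + 1 / 2) / √Real.pi := by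
  rw [integral_gaussianReal_eq_integral_smul one_ne_zero]
  have h1 : ∀ x : ℝ, gaussianPDFReal 0 1 x • x ^ (2 * q)
      = (fun y : ℝ => (√(2 * Real.pi))⁻¹ * (y ^ ((2 * q : ℕ) : ℝ)
          * Real.exp (-(1 / 2) * y ^ (2 : ℝ)))) |x| := by
    intro x
    simp only [gaussianPDFReal, smul_eq_mul, Real.rpow_natCast]
    rw [Real.rpow_two, sq_abs, pow_mul |x|, sq_abs, ← pow_mul]
    simp only [NNReal.coe_one, mul_one, sub_zero]
    rw [show -x ^ 2 / 2 = -(1 / 2) * x ^ 2 by ring]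
    ring
  rw [(integral_congr_ae (Eventually.of_forall h1)).trans (integral_comp_abs
    (f := fun y : ℝ => (√(2 * Real.pi))⁻¹ * (y ^ ((2 * q : ℕ) : ℝ)
          * Real.exp (-(1 / 2) * y ^ (2 : ℝ)))))]
  rw [integral_const_mul,
    integral_rpow_mul_exp_neg_mul_rpow (by norm_num)
      (lt_of_lt_of_le (by norm_num) (Nat.cast_nonneg _)) (by norm_num)]
  have e1 : (((2 * q : ℕ) : ℝ) + 1) / 2 = q + 1 / 2 := by push_cast; ring
  have e2 : (1 / 2 : ℝ) ^ (-(((2 * q : ℕ) : ℝ) + 1) / 2) = 2 ^ q * √2 := by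
    rw [neg_div, e1, one_div, Real.inv_rpow (by norm_num), ← Real.rpow_neg (by norm_num), neg_neg,
      Real.rpow_add (by norm_num), Real.rpow_natCast, Real.sqrt_eq_rpow]
    norm_num
  rw [e1, e2, Real.sqrt_mul (by norm_num)]
  have : √(2 : ℝ) ≠ 0 := by positivity
  have : √Real.pi ≠ 0 := by positivity
  field_simp

lemma moment_succ (q : ℕ) : ∫ t, t ^ (2 * (q + 1)) ∂(gaussianReal 0 1)
    = (2 * (q : ℝ) + 1) * ∫ t, t ^ (2 * q) ∂(gaussianReal 0 1) := by
  rw [moment_eq, moment_eq]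
  have : ((q + 1 : ℕ) : ℝ) + 1 / 2 = ((q : ℝ) + 1 / 2) + 1 := by push_cast; ring
  rw [this, Real.Gamma_add_one (by positivity)]
  ring

lemma moment_lb (q : ℕ) (hq : 0 < q) :
    (q : ℝ) ^ 2 * ((q : ℝ) / 16) ^ q ≤ ∫ t, t ^ (2 * q) ∂(gaussianReal 0 1) := by
  induction q, hq using Nat.le_induction with
  | base =>
    rw [show Nat.succ 0 = 0 + 1 from rfl, moment_succ]
    norm_num
  | succ q hq ih =>
    rw [moment_succ]
    have hq1 : (1 : ℝ) ≤ q := by exact_mod_cast hq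
    have hq0 : (0 : ℝ) < q := by linarith
    refine le_trans ?_ (mul_le_mul_of_nonneg_left ih (by positivity))
    have hk : ((q : ℝ) + 1) ^ q ≤ 3 * (q : ℝ) ^ q := by
      have h1 : (1 + 1 / (q : ℝ)) ^ q ≤ 3 := by
        calc (1 + 1 / (q : ℝ)) ^ q ≤ (Real.exp (1 / q)) ^ q := by
              gcongr
              linarith [Real.add_one_le_exp (1 / (q : ℝ))]
          _ = Real.exp 1 := by
              rw [← Real.exp_nat_mul]; congr 1; field_simp
          _ ≤ 3 := by linarith [Real.exp_one_lt_d9]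
      calc ((q : ℝ) + 1) ^ q = (1 + 1 / (q : ℝ)) ^ q * (q : ℝ) ^ q := by
            rw [← mul_pow]; congr 1; field_simp
        _ ≤ _ := by gcongr
    have hs : ((q : ℝ) + 1) ^ 2 ≤ 4 * (q : ℝ) ^ 2 := by nlinarith
    push_cast
    rw [div_pow, div_pow, pow_succ (_ + _) q, pow_succ (16 : ℝ) q]
    calc ((q : ℝ) + 1) ^ 2 * (((q : ℝ) + 1) ^ q * (q + 1) / (16 ^ q * 16))
        ≤ (4 * (q : ℝ) ^ 2) * ((3 * (q : ℝ) ^ q) * (q + 1) / (16 ^ q * 16)) := by gcongr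
      _ = (12 / 16 * (q + 1)) * ((q : ℝ) ^ 2 * ((q : ℝ) ^ q / 16 ^ q)) := by ring
      _ ≤ _ := by gcongr; linarith

lemma thr_lb (q : ℕ) (hq : 0 < q) : √((q : ℝ) / 16) ≤
    ((∫ t, t ^ (2 * q) ∂(gaussianReal 0 1)) / (q : ℝ) ^ 2) ^ ((1 : ℝ) / (2 * (q : ℝ))) := by
  have hq0 : (0 : ℝ) < q := by exact_mod_cast hq
  have h : ((q : ℝ) / 16) ^ q ≤ (∫ t, t ^ (2 * q) ∂(gaussianReal 0 1)) / (q : ℝ) ^ 2 := by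
    rw [le_div_iff₀ (by positivity), mul_comm]
    exact moment_lb q hq
  calc √((q : ℝ) / 16) = (((q : ℝ) / 16) ^ q) ^ ((1 : ℝ) / (2 * (q : ℝ))) := by
        rw [← Real.rpow_natCast, ← Real.rpow_mul (by positivity), Real.sqrt_eq_rpow]
        congr 1; field_simp
    _ ≤ _ := Real.rpow_le_rpow (by positivity) h (by positivity)

lemma tail_le (s : ℝ) (hs : 0 ≤ s) :
    (gaussianReal 0 1).real {x : ℝ | s ≤ |x|} ≤ 2 * Real.exp (-s ^ 2 / 2) := by
  have h : HasSubgaussianMGF (fun x : ℝ => x) 1 (gaussianReal 0 1) :=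
    ⟨fun t => integrable_exp_mul_gaussianReal t, fun t => by
      rw [mgf_fun_id_gaussianReal]; simp⟩
  have h1 := h.measure_ge_le hs
  have h2 := h.neg.measure_ge_le hs
  have hsub : {x : ℝ | s ≤ |x|} ⊆ {x : ℝ | s ≤ x} ∪ {x : ℝ | s ≤ (-fun x : ℝ => x) x} := by
    intro x hx
    simpa [le_abs] using hx
  have h3 := measureReal_mono (μ := gaussianReal 0 1) hsub
  have h4 := measureReal_union_le (μ := gaussianReal 0 1) {x : ℝ | s ≤ x}
    {x : ℝ | s ≤ (-fun x : ℝ => x) x}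
  simp only [NNReal.coe_one, mul_one] at h1 h2
  linarith

/-- Verification of the technical condition of the Order Disguise theorem for a standard
Gaussian: there is `C₀ > 0` such that whenever `qₙ ≥ C₀ ln n` for all large `n`,
`n · P(|X| ≥ (E[X^{2qₙ}]/qₙ²)^{1/(2qₙ)}) → 0`. -/
theorem stmt9 :
    ∃ C₀ > (0:ℝ), ∀ q : ℕ → ℕ, (∀ n, 0 < q n) →
      (∀ᶠ n : ℕ in atTop, C₀ * Real.log n ≤ (q n : ℝ)) →
      Tendsto
        (fun n : ℕ => (n : ℝ) *
          ((gaussianReal 0 1)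
            {x : ℝ |
              ((∫ t, t ^ (2 * q n) ∂(gaussianReal 0 1)) / (q n : ℝ) ^ 2)
                  ^ ((1 : ℝ) / (2 * (q n : ℝ))) ≤ |x|}).toReal)
        atTop (nhds 0) := by
  refine ⟨64, by norm_num, fun q hq hlog => ?_⟩
  refine squeeze_zero' (g := fun n : ℕ => 2 / (n : ℝ)) (Eventually.of_forall fun n => by positivity)
    ?_ (tendsto_const_div_atTop_nhds_zero_nat 2)
  filter_upwards [hlog, eventually_gt_atTop 0] with n hn hn0
  have hn0' : (0 : ℝ) < n := by exact_mod_cast hn0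
  have hsub := measureReal_mono (μ := gaussianReal 0 1)
    (s₁ := {x : ℝ | ((∫ t, t ^ (2 * q n) ∂(gaussianReal 0 1)) / (q n : ℝ) ^ 2)
                  ^ ((1 : ℝ) / (2 * (q n : ℝ))) ≤ |x|})
    (s₂ := {x : ℝ | √((q n : ℝ) / 16) ≤ |x|}) (fun x hx => le_trans (thr_lb (q n) (hq n)) hx)
  have ht := tail_le (√((q n : ℝ) / 16)) (Real.sqrt_nonneg _)
  rw [Real.sq_sqrt (by positivity)] at ht
  have he : Real.exp (-((q n : ℝ) / 16) / 2) ≤ 1 / (n : ℝ) ^ 2 := by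
    calc Real.exp (-((q n : ℝ) / 16) / 2) ≤ Real.exp (-(2 * Real.log n)) := by
          apply Real.exp_le_exp.mpr; linarith
      _ = 1 / (n : ℝ) ^ 2 := by
          rw [Real.exp_neg, two_mul, Real.exp_add, Real.exp_log hn0', one_div, sq]
  calc _ ≤ (n : ℝ) * (2 * (1 / (n : ℝ) ^ 2)) := by
        apply mul_le_mul_of_nonneg_left _ hn0'.le
        exact (hsub.trans ht).trans (by linarith)
    _ = 2 / (n : ℝ) := by field_simp
end
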